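/- Let 1 ≤ d < n be integers, α₀ ∈ ℝ^{n−d}, A ∈ ℝ^{d×(n−d)}, Ã the (d+1)×(n−d) matrix with first row α₀ and remaining rows A, and H = {(x, (1,x)·Ã) : x ∈ ℝ^d} ⊆ ℝ^n. Let 0 < s ≤ d be real and let ψ: ℕ → ℝ_{≥0} be any approximation function (no monotonicity assumed). If ∑_{q=1}^∞ ψ(q)^{n−d+s} q^{d−s} < ∞ and the multiplicative diophantine type satisfies ω(A) < d(n−d+s)/(d+1−s), then the s-dimensional Hausdorff measure of S_n(ψ) ∩ H is zero. -/

import Mathlib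

open MeasureTheory
open scoped ENNReal NNReal

/-- Distance to the nearest integer. -/
noncomputable def dNI (y : ℝ) : ℝ := |y - round y|

/-- Supremum norm of an integer vector, as a natural number. -/
def jnorm {m : ℕ} (j : Fin m → ℤ) : ℕ := Finset.univ.sup fun i => (j i).natAbs

/-- The multiplicative diophantine type `ω(M)` of a matrix `M ∈ ℝ^{l×m}`:
the least upper bound of all `ω > 0` such that
`∏_{u=1}^l ‖j ⬝ row_u M‖ < |j|^{-ω}` has infinitely many solutions `j ∈ ℤ^m`. -/
noncomputable def multType {l m : ℕ} (M : Matrix (Fin l) (Fin m) ℝ) : ℝ≥0∞ :=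
  sSup {w : ℝ≥0∞ | ∃ ω : ℝ, 0 < ω ∧ w = ENNReal.ofReal ω ∧
    {j : Fin m → ℤ | j ≠ 0 ∧
      (∏ u, dNI (∑ v, (j v : ℝ) * M u v)) < (jnorm j : ℝ) ^ (-ω)}.Infinite}

lemma dNI_nonneg (y : ℝ) : 0 ≤ dNI y := abs_nonneg _

lemma dNI_le_half (y : ℝ) : dNI y ≤ 1 / 2 := abs_sub_round y

lemma dNI_le_abs_sub_intCast (y : ℝ) (k : ℤ) : dNI y ≤ |y - k| := round_le y k

lemma dNI_le_add_abs_sub (x y : ℝ) : dNI x ≤ dNI y + |x - y| := by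
  refine (dNI_le_abs_sub_intCast x (round y)).trans ?_
  calc |x - round y| = |(y - round y) + (x - y)| := by ring_nf
    _ ≤ _ := abs_add_le _ _

lemma dNI_sub_le_abs (x y : ℝ) : dNI (x - y) ≤ |(x - round x) - (y - round y)| := by
  refine (dNI_le_abs_sub_intCast (x - y) (round x - round y)).trans (le_of_eq ?_)
  push_cast
  ring_nf

lemma dNI_sub_le (x y : ℝ) : dNI (x - y) ≤ dNI x + dNI y :=
  (dNI_sub_le_abs x y).trans (abs_sub _ _)

lemma dNI_intCast_mul_eq_zero {y : ℝ} (h : dNI y = 0) (k : ℤ) : dNI (k * y) = 0 := by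
  have hy : y = round y := sub_eq_zero.mp (abs_eq_zero.mp h)
  refine le_antisymm ((dNI_le_abs_sub_intCast _ (k * round y)).trans ?_) (dNI_nonneg _)
  push_cast
  rw [← hy]
  simp

lemma prod_dNI_nonneg {d : ℕ} (x : Fin d → ℝ) : 0 ≤ ∏ u, dNI (x u) :=
  Finset.prod_nonneg fun _ _ => dNI_nonneg _

lemma jnorm_pos {m : ℕ} {j : Fin m → ℤ} (hj : j ≠ 0) : 0 < jnorm j := by
  obtain ⟨i, hi⟩ := Function.ne_iff.mp hj
  exact (Int.natAbs_pos.mpr hi).trans_le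
    (Finset.le_sup (f := fun i => (j i).natAbs) (Finset.mem_univ i))

/-- If the multiplicative type of `A` is less than `T`, then the products
`∏ ‖j ⬝ row_u A‖` are bounded below by a power of `|j|` with exponent less than `T`. -/
lemma exists_lower_bound_of_multType_lt {d m : ℕ} (A : Matrix (Fin d) (Fin m) ℝ) (T : ℝ)
    (h : multType A < ENNReal.ofReal T) :
    ∃ ω : ℝ, 0 < ω ∧ ω < T ∧ ∃ c : ℝ, 0 < c ∧ c ≤ 1 ∧ ∀ j : Fin m → ℤ, j ≠ 0 →
      c * (jnorm j : ℝ) ^ (-ω) ≤ ∏ u, dNI (∑ v, (j v : ℝ) * A u v) := by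
  obtain ⟨w, hw1, hw2⟩ := exists_between h
  have hwtop : w ≠ ⊤ := hw2.ne_top
  have hwpos : 0 < w := zero_le.trans_lt hw1
  set ω := w.toReal with hωdef
  have hω : 0 < ω := ENNReal.toReal_pos hwpos.ne' hwtop
  have hwω : w = ENNReal.ofReal ω := (ENNReal.ofReal_toReal hwtop).symm
  have hfin : {j : Fin m → ℤ | j ≠ 0 ∧
      (∏ u, dNI (∑ v, (j v : ℝ) * A u v)) < (jnorm j : ℝ) ^ (-ω)}.Finite := by
    by_contra hinf
    exact absurd hw1 (not_lt.mpr (le_sSup ⟨ω, hω, hwω, hinf⟩))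
  have hpos : ∀ j : Fin m → ℤ, j ≠ 0 → 0 < ∏ u, dNI (∑ v, (j v : ℝ) * A u v) := by
    intro j hj
    refine lt_of_le_of_ne (prod_dNI_nonneg _) fun h0 => ?_
    obtain ⟨u, -, hu⟩ := Finset.prod_eq_zero_iff.mp h0.symm
    have hinj : Function.Injective fun k : ℕ => ((k : ℤ) + 1) • j := by
      intro k k' hk
      obtain ⟨i, hi⟩ := Function.ne_iff.mp hj
      have := congrFun hk i
      simp only [Pi.smul_apply, smul_eq_mul] at this
      have := mul_right_cancel₀ hi this
      omega
    refine (Set.infinite_range_of_injective hinj) (hfin.subset ?_)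
    rintro _ ⟨k, rfl⟩
    have hne : ((k : ℤ) + 1) • j ≠ 0 := smul_ne_zero (by omega) hj
    refine ⟨hne, ?_⟩
    have h1 : ∏ u, dNI (∑ v, ((((k : ℤ) + 1) • j) v : ℝ) * A u v) = 0 := by
      refine Finset.prod_eq_zero (Finset.mem_univ u) ?_
      rw [← dNI_intCast_mul_eq_zero hu ((k : ℤ) + 1), Finset.mul_sum]
      congr 1
      refine Finset.sum_congr rfl fun v _ => ?_
      simp only [Pi.smul_apply, smul_eq_mul]
      push_cast
      ring
    rw [h1]
    exact Real.rpow_pos_of_pos (Nat.cast_pos.mpr (jnorm_pos hne)) _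
  refine ⟨ω, hω, ?_, ?_⟩
  · rw [hwω] at hw2
    exact (ENNReal.ofReal_lt_ofReal_iff_of_nonneg hω.le).mp hw2
  · set S := {j : Fin m → ℤ | j ≠ 0 ∧
      (∏ u, dNI (∑ v, (j v : ℝ) * A u v)) < (jnorm j : ℝ) ^ (-ω)} with hS
    have key : ∃ c : ℝ, 0 < c ∧ ∀ j ∈ S, c ≤ ∏ u, dNI (∑ v, (j v : ℝ) * A u v) := by
      rcases S.eq_empty_or_nonempty with he | hne
      · exact ⟨1, one_pos, by simp [he]⟩
      · obtain ⟨a, ha, hmin⟩ := Set.exists_min_image S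
          (fun j => ∏ u, dNI (∑ v, (j v : ℝ) * A u v)) hfin hne
        exact ⟨_, hpos a ha.1, hmin⟩
    obtain ⟨c, hc, hcS⟩ := key
    refine ⟨min c 1, lt_min hc one_pos, min_le_right _ _, fun j hj => ?_⟩
    have hj1 : (1 : ℝ) ≤ jnorm j := by exact_mod_cast jnorm_pos hj
    have hr0 : 0 < (jnorm j : ℝ) ^ (-ω) := Real.rpow_pos_of_pos (by linarith) _
    have hr1 : (jnorm j : ℝ) ^ (-ω) ≤ 1 :=
      Real.rpow_le_one_of_one_le_of_nonpos hj1 (by linarith)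
    by_cases hjS : j ∈ S
    · exact ((mul_le_mul (min_le_left c 1) hr1 hr0.le hc.le).trans_eq (mul_one c)).trans
        (hcS j hjS)
    · have : (jnorm j : ℝ) ^ (-ω) ≤ ∏ u, dNI (∑ v, (j v : ℝ) * A u v) := by
        by_contra hlt
        exact hjS ⟨hj, not_le.mp hlt⟩
      exact (mul_le_of_le_one_left hr0.le (min_le_right _ _)).trans this

/-- A family of points whose differences are multiplicatively bounded away from the integers
has few members in a dyadic box. -/
lemma card_mul_le_of_separated {ι : Type*} {d : ℕ} (u₀ : Fin d) (B : Finset ι)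
    (t : ι → Fin d → ℝ) {θ : ℝ} (hθ : 0 < θ)
    (hsep : ∀ i ∈ B, ∀ i' ∈ B, i ≠ i' → θ ≤ ∏ u, dNI (t i u - t i' u))
    (w : Fin d → ℝ) (hw : ∀ u, 0 < w u) (ht : ∀ i ∈ B, ∀ u, dNI (t i u) ≤ w u) :
    (B.card : ℝ) ≤ 2 ^ d * (∏ u, w u) / θ + 2 := by
  set P := ∏ u, w u with hP
  have hP0 : 0 < P := Finset.prod_pos fun u _ => hw u
  set M := ⌊2 ^ d * P / θ⌋₊ + 1 with hM
  have hMlt : 2 ^ d * P / θ < M := by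
    rw [hM]; push_cast; exact Nat.lt_floor_add_one _
  have hM0 : (0 : ℝ) < M := by rw [hM]; positivity
  have hMle : (M : ℝ) ≤ 2 ^ d * P / θ + 1 := by
    rw [hM]; push_cast; gcongr; exact Nat.floor_le (by positivity)
  have hw0 := hw u₀
  let g : ι → ℤ := fun i => ⌊(t i u₀ - round (t i u₀) + w u₀) * (M / (2 * w u₀))⌋
  have hcard : B.card ≤ (Finset.Icc (0 : ℤ) M).card := by
    refine Finset.card_le_card_of_injOn g ?_ ?_
    · intro i hi
      have hb := abs_le.mp (ht i hi u₀)
      simp only [Finset.coe_Icc, Set.mem_Icc, g]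
      constructor
      · apply Int.floor_nonneg.mpr
        have : 0 ≤ t i u₀ - round (t i u₀) + w u₀ := by linarith [hb.1]
        positivity
      · have h1 : (t i u₀ - round (t i u₀) + w u₀) * (M / (2 * w u₀)) ≤ (M : ℤ) := by
          calc _ ≤ (2 * w u₀) * (M / (2 * w u₀)) := by
                gcongr; linarith [hb.2]
            _ = (M : ℤ) := by push_cast; field_simp
        exact_mod_cast (Int.floor_le _).trans h1
    · intro i hi i' hi' hg
      by_contra hne
      have h1 := Int.abs_sub_lt_one_of_floor_eq_floor hg
      have h2 : |(t i u₀ - round (t i u₀)) - (t i' u₀ - round (t i' u₀))| < 2 * w u₀ / M := by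
        rw [← sub_mul, abs_mul, abs_of_pos (by positivity : 0 < (M : ℝ) / (2 * w u₀)),
          add_sub_add_right_eq_sub] at h1
        rw [lt_div_iff₀ hM0]
        rw [mul_div_assoc', div_lt_one (by positivity)] at h1
        exact h1
      have h3 : ∏ u, dNI (t i u - t i' u) ≤
          ∏ u, (2 * w u) * (if u = u₀ then 1 / (M : ℝ) else 1) := by
        refine Finset.prod_le_prod (fun _ _ => dNI_nonneg _) fun u _ => ?_
        split_ifs with hu
        · subst hu
          rw [mul_one_div]
          exact (dNI_sub_le_abs _ _).trans h2.le
        · have := dNI_sub_le (t i u) (t i' u)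
          linarith [ht i hi u, ht i' hi' u]
      rw [Finset.prod_mul_distrib, Finset.prod_mul_distrib, Finset.prod_ite_eq' , ← hP] at h3
      simp only [Finset.prod_const, Finset.card_univ, Fintype.card_fin, Finset.mem_univ,
        if_true] at h3
      have h4 : 2 ^ d * P * (1 / M) < θ := by
        rw [mul_one_div, div_lt_iff₀ hM0]
        rw [div_lt_iff₀ hθ] at hMlt
        linarith
      linarith [hsep i hi i' hi' hne]
  have h5 : (B.card : ℝ) ≤ M + 1 := by
    have : (Finset.Icc (0 : ℤ) M).card = M + 1 := by simp
    rw [this] at hcard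
    exact_mod_cast hcard
  linarith

/-- Sums of `∏ 1 / ‖t_u‖` over multiplicatively separated families are almost as small as the
largest possible term. -/
lemma exists_sum_inv_prod_dNI_le {d : ℕ} (hd : 1 ≤ d) {ε : ℝ} (hε : 0 < ε) :
    ∃ C : ℝ, 0 < C ∧ ∀ (ι : Type) (B : Finset ι) (t : ι → Fin d → ℝ) (θ : ℝ), 0 < θ → θ ≤ 1 →
      (∀ i ∈ B, θ ≤ ∏ u, dNI (t i u)) →
      (∀ i ∈ B, ∀ i' ∈ B, i ≠ i' → θ ≤ ∏ u, dNI (t i u - t i' u)) →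
      ∑ i ∈ B, (∏ u, dNI (t i u))⁻¹ ≤ C * θ ^ (-(1 + ε)) := by
  have hd0 : (0 : ℝ) < d := by exact_mod_cast hd
  set e := ε / d with he
  have he0 : 0 < e := by positivity
  set E := 1 / (e * Real.log 2) with hE
  have hlog2 : 0 < Real.log 2 := Real.log_pos one_lt_two
  have hE0 : 0 < E := by positivity
  refine ⟨(E + 1) ^ d * ((2 ^ d + 2) * 2 ^ d), by positivity, ?_⟩
  intro ι B t θ hθ hθ1 hlow hsep
  have hex : ∀ x : ℝ, ∃ k : ℕ, 0 < x → x ≤ 1 → (1 / 2 : ℝ) ^ (k + 1) < x ∧ x ≤ (1 / 2) ^ k := by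
    intro x
    by_cases hx : 0 < x ∧ x ≤ 1
    · obtain ⟨k, hk⟩ := exists_nat_pow_near_of_lt_one hx.1 hx.2
        (by norm_num : (0 : ℝ) < 1 / 2) (by norm_num)
      exact ⟨k, fun _ _ => hk⟩
    · exact ⟨0, fun h1 h2 => absurd ⟨h1, h2⟩ hx⟩
  choose κ hκ using hex
  have hle1 : ∀ y, dNI y ≤ 1 := fun y => (dNI_le_half y).trans (by norm_num)
  have hfac : ∀ i ∈ B, ∀ u, θ ≤ dNI (t i u) := by
    intro i hi u
    refine (hlow i hi).trans ?_
    rw [← Finset.mul_prod_erase _ _ (Finset.mem_univ u)]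
    exact mul_le_of_le_one_right (dNI_nonneg _)
      (Finset.prod_le_one (fun _ _ => dNI_nonneg _) fun _ _ => hle1 _)
  have hκB : ∀ i ∈ B, ∀ u, (1 / 2 : ℝ) ^ (κ (dNI (t i u)) + 1) < dNI (t i u) ∧
      dNI (t i u) ≤ (1 / 2) ^ κ (dNI (t i u)) := fun i hi u =>
    hκ _ (hθ.trans_le (hfac i hi u)) (hle1 _)
  set K := ⌊E * θ ^ (-e)⌋₊ + 1 with hK
  have hθe : 1 ≤ θ ^ (-e) := Real.one_le_rpow_of_pos_of_le_one_of_nonpos hθ hθ1 (by linarith)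
  have hKle : (K : ℝ) ≤ (E + 1) * θ ^ (-e) := by
    rw [hK]; push_cast
    have := Nat.floor_le (by positivity : 0 ≤ E * θ ^ (-e))
    linarith
  have hmaps : ∀ i ∈ B, (fun u => κ (dNI (t i u))) ∈
      Fintype.piFinset fun _ : Fin d => Finset.range K := by
    intro i hi
    rw [Fintype.mem_piFinset]
    intro u
    rw [Finset.mem_range, hK, Nat.lt_succ_iff]
    apply Nat.le_floor
    set k := κ (dNI (t i u))
    have h1 : θ ≤ (1 / 2) ^ k := (hfac i hi u).trans (hκB i hi u).2
    have h2 : (2 : ℝ) ^ k ≤ θ⁻¹ := by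
      rw [one_div, inv_pow] at h1
      exact (le_inv_comm₀ (by positivity) hθ).mpr h1
    have h3 := Real.log_le_rpow_div (by positivity : (0 : ℝ) ≤ θ⁻¹) he0
    have h4 := Real.log_le_log (by positivity) h2
    rw [Real.log_pow] at h4
    rw [Real.inv_rpow hθ.le, ← Real.rpow_neg hθ.le] at h3
    have h5 : E * θ ^ (-e) = θ ^ (-e) / e / Real.log 2 := by
      rw [hE]; field_simp
    rw [h5, le_div_iff₀ hlog2]
    linarith
  rw [← Finset.sum_fiberwise_of_maps_to hmaps]
  have hcell : ∀ p ∈ Fintype.piFinset fun _ : Fin d => Finset.range K,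
      ∑ i ∈ B with (fun u => κ (dNI (t i u))) = p, (∏ u, dNI (t i u))⁻¹ ≤
        (2 ^ d + 2) * 2 ^ d / θ := by
    intro p _
    set F := B.filter fun i => (fun u => κ (dNI (t i u))) = p with hF
    have hFB : ∀ i ∈ F, i ∈ B := fun i hi => (Finset.mem_filter.mp hi).1
    have hFp : ∀ i ∈ F, ∀ u, κ (dNI (t i u)) = p u := fun i hi u =>
      congrFun (Finset.mem_filter.mp hi).2 u
    rcases F.eq_empty_or_nonempty with hemp | ⟨i₀, hi₀⟩
    · rw [hemp]; simp only [Finset.sum_empty]; positivity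
    set P := ∏ u, (1 / 2 : ℝ) ^ p u with hP
    have hP0 : 0 < P := Finset.prod_pos fun u _ => by positivity
    have hup : ∀ i ∈ F, ∀ u, dNI (t i u) ≤ (1 / 2 : ℝ) ^ p u := fun i hi u => by
      have := (hκB i (hFB i hi) u).2
      rwa [hFp i hi u] at this
    have hθP : θ ≤ P := (hlow i₀ (hFB i₀ hi₀)).trans
      (Finset.prod_le_prod (fun _ _ => dNI_nonneg _) fun u _ => hup i₀ hi₀ u)
    have hcard := card_mul_le_of_separated (⟨0, hd⟩ : Fin d) F t hθ
      (fun i hi i' hi' => hsep i (hFB i hi) i' (hFB i' hi')) (fun u => (1 / 2 : ℝ) ^ p u)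
      (fun u => by positivity) hup
    rw [← hP] at hcard
    have hterm : ∀ i ∈ F, (∏ u, dNI (t i u))⁻¹ ≤ 2 ^ d / P := by
      intro i hi
      have h1 : P / 2 ^ d ≤ ∏ u, dNI (t i u) := by
        calc P / 2 ^ d = ∏ u, (1 / 2 : ℝ) ^ (p u + 1) := by
              simp_rw [pow_succ]
              rw [Finset.prod_mul_distrib, ← hP]
              simp [div_eq_mul_inv]
          _ ≤ _ := Finset.prod_le_prod (fun _ _ => by positivity) fun u _ => by
              have := (hκB i (hFB i hi) u).1.le
              rwa [hFp i hi u] at this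
      calc _ ≤ (P / 2 ^ d)⁻¹ := inv_anti₀ (by positivity) h1
        _ = _ := inv_div _ _
    calc ∑ i ∈ F, (∏ u, dNI (t i u))⁻¹ ≤ F.card • (2 ^ d / P) :=
          Finset.sum_le_card_nsmul _ _ _ hterm
      _ = F.card * (2 ^ d / P) := nsmul_eq_mul _ _
      _ ≤ ((2 ^ d + 2) * P / θ) * (2 ^ d / P) := by
          gcongr
          refine hcard.trans ?_
          have : 1 ≤ P / θ := (one_le_div hθ).mpr hθP
          rw [mul_div_assoc, mul_div_assoc]
          linarith
      _ = _ := by field_simp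
  refine (Finset.sum_le_card_nsmul _ _ _ hcell).trans ?_
  rw [nsmul_eq_mul, Fintype.card_piFinset]
  simp only [Finset.card_range, Finset.prod_const, Finset.card_univ, Fintype.card_fin]
  push_cast
  calc (K : ℝ) ^ d * ((2 ^ d + 2) * 2 ^ d / θ)
      ≤ ((E + 1) * θ ^ (-e)) ^ d * ((2 ^ d + 2) * 2 ^ d / θ) := by gcongr
    _ = (E + 1) ^ d * ((2 ^ d + 2) * 2 ^ d) * ((θ ^ (-e)) ^ d * θ⁻¹) := by
        rw [mul_pow]; ring
    _ = _ := by
        congr 1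
        rw [← Real.rpow_natCast, ← Real.rpow_mul hθ.le, ← Real.rpow_neg_one θ,
          ← Real.rpow_add hθ]
        congr 1
        rw [he]; field_simp; ring

/-- The additive character `t ↦ exp (2πit)`. -/
noncomputable def unitExp (t : ℝ) : ℂ := Complex.exp (Complex.I * (2 * Real.pi * t : ℝ))

lemma norm_unitExp (t : ℝ) : ‖unitExp t‖ = 1 := Complex.norm_exp_I_mul_ofReal _

lemma unitExp_add (s t : ℝ) : unitExp (s + t) = unitExp s * unitExp t := by
  rw [unitExp, unitExp, unitExp, ← Complex.exp_add]
  congr 1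
  push_cast
  ring

lemma unitExp_zero : unitExp 0 = 1 := by simp [unitExp]

lemma unitExp_sum {ι : Type*} (s : Finset ι) (f : ι → ℝ) :
    unitExp (∑ i ∈ s, f i) = ∏ i ∈ s, unitExp (f i) := by
  classical
  induction s using Finset.induction_on with
  | empty => simp [unitExp_zero]
  | insert a s ha ih => rw [Finset.sum_insert ha, Finset.prod_insert ha, unitExp_add, ih]

lemma unitExp_intCast (k : ℤ) : unitExp k = 1 := by
  rw [unitExp, Complex.exp_eq_one_iff]
  exact ⟨k, by push_cast; ring⟩

lemma unitExp_natCast_mul (k : ℕ) (t : ℝ) : unitExp (k * t) = unitExp t ^ k := by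
  rw [unitExp, unitExp, ← Complex.exp_nat_mul]
  congr 1
  push_cast
  ring

lemma unitExp_sub_round (t : ℝ) : unitExp (t - round t) = unitExp t := by
  have h := unitExp_add (t - round t) (round t)
  rw [unitExp_intCast, mul_one, sub_add_cancel] at h
  exact h.symm

lemma conj_unitExp (t : ℝ) : (starRingEnd ℂ) (unitExp t) = unitExp (-t) := by
  rw [unitExp, unitExp, ← Complex.exp_conj]
  rw [map_mul, Complex.conj_I, Complex.conj_ofReal]
  congr 1
  push_cast
  ring

lemma four_mul_dNI_le_norm_unitExp_sub_one (t : ℝ) : 4 * dNI t ≤ ‖unitExp t - 1‖ := by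
  rw [← unitExp_sub_round, unitExp, Complex.norm_exp_I_mul_ofReal_sub_one]
  have hz : |t - round t| ≤ 1 / 2 := abs_sub_round t
  have hpi := Real.pi_pos
  have h := Real.mul_abs_le_abs_sin (x := Real.pi * (t - round t)) (by
    rw [abs_mul, abs_of_pos hpi]; nlinarith)
  rw [abs_mul, abs_of_pos hpi] at h
  have h1 : 2 * Real.pi * (t - round t) / 2 = Real.pi * (t - round t) := by ring
  rw [h1, norm_mul, Real.norm_eq_abs, Real.norm_eq_abs, abs_two, dNI]
  have h2 : 2 / Real.pi * (Real.pi * |t - round t|) = 2 * |t - round t| := by field_simp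
  rw [h2] at h
  linarith

lemma norm_sum_unitExp_le (N : ℕ) {t : ℝ} (ht : 0 < dNI t) :
    ‖∑ k ∈ Finset.range N, unitExp (k * t)‖ ≤ (dNI t)⁻¹ := by
  have h1 := four_mul_dNI_le_norm_unitExp_sub_one t
  have hne : unitExp t ≠ 1 := by
    intro h
    rw [h, sub_self, norm_zero] at h1
    linarith
  simp_rw [unitExp_natCast_mul]
  rw [geom_sum_eq hne, norm_div, div_le_iff₀ (by linarith)]
  have h2 : ‖unitExp t ^ N - 1‖ ≤ 2 := by
    refine (norm_sub_le _ _).trans ?_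
    rw [norm_pow, norm_unitExp, one_pow, norm_one]
    norm_num
  calc ‖unitExp t ^ N - 1‖ ≤ 4 := by linarith
    _ = (dNI t)⁻¹ * (4 * dNI t) := by field_simp
    _ ≤ _ := by gcongr

lemma half_le_norm_sum_unitExp {J : ℕ} (hJ : 1 ≤ J) {y : ℝ} (hy : dNI y ≤ 1 / (8 * J)) :
    (J : ℝ) / 2 ≤ ‖∑ k ∈ Finset.range J, unitExp (k * y)‖ := by
  have hJ0 : (0 : ℝ) < J := by exact_mod_cast hJ
  refine le_trans ?_ (Complex.re_le_norm _)
  rw [Complex.re_sum]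
  have h : ∀ k ∈ Finset.range J, (1 / 2 : ℝ) ≤ (unitExp (k * y)).re := by
    intro k hk
    have hkJ : (k : ℝ) ≤ J := by exact_mod_cast (Finset.mem_range.mp hk).le
    rw [unitExp_natCast_mul, ← unitExp_sub_round, ← unitExp_natCast_mul, unitExp, mul_comm,
      Complex.exp_ofReal_mul_I_re]
    refine le_trans ?_ (Real.one_sub_sq_div_two_le_cos)
    have h1 : |(k : ℝ) * (y - round y)| ≤ 1 / 8 := by
      rw [abs_mul, Nat.abs_cast]
      calc (k : ℝ) * |y - round y| ≤ J * (1 / (8 * J)) := by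
            gcongr
            exact hy
        _ = 1 / 8 := by field_simp
    have h2 : ((k : ℝ) * (y - round y)) ^ 2 ≤ (1 / 8) ^ 2 := sq_le_sq' (abs_le.mp h1).1 (abs_le.mp h1).2
    have h3 : Real.pi ^ 2 ≤ 10 := by nlinarith [Real.pi_lt_d2, Real.pi_pos]
    have h4 : (2 * Real.pi * ((k : ℝ) * (y - round y))) ^ 2 ≤ 4 * 10 * (1 / 8) ^ 2 := by
      rw [mul_pow, mul_pow]
      gcongr
      norm_num
    linarith
  calc (J : ℝ) / 2 = ∑ _k ∈ Finset.range J, (1 / 2 : ℝ) := by simp; ring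
    _ ≤ _ := Finset.sum_le_sum h

/-- The cube `{0, …, N - 1}^d`. -/
def natCube (d N : ℕ) : Finset (Fin d → ℕ) := Fintype.piFinset fun _ => Finset.range N

lemma card_natCube (d N : ℕ) : (natCube d N).card = N ^ d := by
  simp [natCube]

lemma sum_natCube_unitExp (d N : ℕ) (y : Fin d → ℝ) :
    ∑ k ∈ natCube d N, unitExp (∑ v, (k v : ℝ) * y v) =
      ∏ v, ∑ k ∈ Finset.range N, unitExp (k * y v) := by
  rw [Finset.prod_univ_sum]
  exact Finset.sum_congr rfl fun k _ => unitExp_sum _ _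

lemma norm_sq_sum_natCube_unitExp (m J : ℕ) (y : Fin m → ℝ) :
    ((‖∑ k ∈ natCube m J, unitExp (∑ v, (k v : ℝ) * y v)‖ ^ 2 : ℝ) : ℂ) =
      ∑ k ∈ natCube m J, ∑ k' ∈ natCube m J,
        unitExp (∑ v, ((k v : ℝ) - k' v) * y v) := by
  push_cast
  rw [← Complex.mul_conj', map_sum, Finset.sum_mul_sum]
  refine Finset.sum_congr rfl fun k _ => Finset.sum_congr rfl fun k' _ => ?_
  rw [conj_unitExp, ← unitExp_add]
  congr 1
  simp_rw [sub_mul]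
  rw [Finset.sum_sub_distrib, sub_eq_add_neg]

/-- An upper bound for the number of points `β + bA` close to the integer lattice, in terms of
exponential sums. -/
lemma card_mul_le_exponential_sum {d m : ℕ} (A : Matrix (Fin d) (Fin m) ℝ) (β : Fin m → ℝ)
    {J : ℕ} (hJ : 1 ≤ J) (N : ℕ) (F : Finset (Fin d → ℕ)) (hF : F ⊆ natCube d N)
    (hclose : ∀ b ∈ F, ∀ v, dNI (β v + ∑ u, (b u : ℝ) * A u v) ≤ 1 / (8 * J)) (G : ℝ)
    (hG : ∀ k ∈ natCube m J, ∑ k' ∈ natCube m J,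
      ∏ u, ‖∑ b ∈ Finset.range N, unitExp (b * ∑ v, ((k v : ℝ) - k' v) * A u v)‖ ≤ G) :
    (F.card : ℝ) * (((J : ℝ) / 2) ^ m) ^ 2 ≤ J ^ m * G := by
  set y : (Fin d → ℕ) → Fin m → ℝ := fun b v => β v + ∑ u, (b u : ℝ) * A u v with hy
  set D : (Fin d → ℕ) → ℂ := fun b => ∑ k ∈ natCube m J, unitExp (∑ v, (k v : ℝ) * y b v) with hD
  have h1 : ∀ b ∈ F, (((J : ℝ) / 2) ^ m) ^ 2 ≤ ‖D b‖ ^ 2 := by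
    intro b hb
    have : ((J : ℝ) / 2) ^ m ≤ ‖D b‖ := by
      rw [hD]
      simp only
      rw [sum_natCube_unitExp, norm_prod]
      calc ((J : ℝ) / 2) ^ m = ∏ _v : Fin m, (J : ℝ) / 2 := by
            rw [Finset.prod_const, Finset.card_univ, Fintype.card_fin]
        _ ≤ _ := Finset.prod_le_prod (fun _ _ => by positivity) fun v _ =>
            half_le_norm_sum_unitExp hJ (hclose b hb v)
    gcongr
  have h2 : (F.card : ℝ) * (((J : ℝ) / 2) ^ m) ^ 2 ≤ ∑ b ∈ natCube d N, ‖D b‖ ^ 2 := by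
    rw [← nsmul_eq_mul]
    exact (Finset.card_nsmul_le_sum _ _ _ h1).trans
      (Finset.sum_le_sum_of_subset_of_nonneg hF fun _ _ _ => by positivity)
  have h3 : ((∑ b ∈ natCube d N, ‖D b‖ ^ 2 : ℝ) : ℂ) =
      ∑ k ∈ natCube m J, ∑ k' ∈ natCube m J, ∑ b ∈ natCube d N,
        unitExp (∑ v, ((k v : ℝ) - k' v) * y b v) := by
    rw [Complex.ofReal_sum]
    simp_rw [hD, norm_sq_sum_natCube_unitExp]
    rw [Finset.sum_comm]
    exact Finset.sum_congr rfl fun k _ => Finset.sum_comm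
  have h4 : ∀ k k' : Fin m → ℕ, ‖∑ b ∈ natCube d N,
      unitExp (∑ v, ((k v : ℝ) - k' v) * y b v)‖ =
      ∏ u, ‖∑ b ∈ Finset.range N, unitExp (b * ∑ v, ((k v : ℝ) - k' v) * A u v)‖ := by
    intro k k'
    have h5 : ∀ b : Fin d → ℕ, ∑ v, ((k v : ℝ) - k' v) * y b v =
        ∑ v, ((k v : ℝ) - k' v) * β v +
          ∑ u, (b u : ℝ) * ∑ v, ((k v : ℝ) - k' v) * A u v := by
      intro b
      simp_rw [hy, mul_add, Finset.sum_add_distrib, Finset.mul_sum]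
      rw [Finset.sum_comm (γ := Fin d)]
      congr 1
      refine Finset.sum_congr rfl fun u _ => Finset.sum_congr rfl fun v _ => ?_
      ring
    simp_rw [h5, unitExp_add]
    rw [← Finset.mul_sum, norm_mul, norm_unitExp, one_mul, sum_natCube_unitExp, norm_prod]
  refine h2.trans ?_
  have h6 : (∑ b ∈ natCube d N, ‖D b‖ ^ 2 : ℝ) =
      ‖((∑ b ∈ natCube d N, ‖D b‖ ^ 2 : ℝ) : ℂ)‖ := by
    rw [Complex.norm_real, Real.norm_of_nonneg]
    positivity
  rw [h6, h3]
  calc _ ≤ ∑ k ∈ natCube m J, G := by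
        refine norm_sum_le_of_le _ fun k hk => (norm_sum_le _ _).trans ?_
        simp_rw [h4]
        exact hG k hk
    _ = J ^ m * G := by
        rw [Finset.sum_const, card_natCube, nsmul_eq_mul]
        push_cast
        rfl

/-- The number of points `β + bA` with `b` in a cube of side `N` lying within `1 / (8J)` of the
integer lattice is of the expected order of magnitude, up to an error controlled by a lower bound
for the products `∏ ‖j ⬝ row_u A‖`. -/
lemma exists_card_le {d m : ℕ} (hd : 1 ≤ d) (A : Matrix (Fin d) (Fin m) ℝ) {ω c ε : ℝ}
    (hω : 0 < ω) (hc : 0 < c) (hc1 : c ≤ 1) (hε : 0 < ε)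
    (hA : ∀ j : Fin m → ℤ, j ≠ 0 →
      c * (jnorm j : ℝ) ^ (-ω) ≤ ∏ u, dNI (∑ v, (j v : ℝ) * A u v)) :
    ∃ C : ℝ, 0 < C ∧ ∀ (β : Fin m → ℝ) (J N : ℕ), 1 ≤ J → ∀ F : Finset (Fin d → ℕ),
      F ⊆ natCube d N →
      (∀ b ∈ F, ∀ v, dNI (β v + ∑ u, (b u : ℝ) * A u v) ≤ 1 / (8 * J)) →
      (F.card : ℝ) ≤ C / (J : ℝ) ^ m * ((N : ℝ) ^ d + (J : ℝ) ^ (ω * (1 + ε))) := by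
  obtain ⟨C, hC, hsum⟩ := exists_sum_inv_prod_dNI_le hd hε
  set C' := max 1 (C * c ^ (-(1 + ε))) with hC'
  have hC'1 : 1 ≤ C' := le_max_left _ _
  refine ⟨4 ^ m * C', by positivity, ?_⟩
  intro β J N hJ F hF hclose
  have hJ0 : (0 : ℝ) < J := by exact_mod_cast hJ
  have hJ1 : (1 : ℝ) ≤ J := by exact_mod_cast hJ
  set θ := c * (J : ℝ) ^ (-ω) with hθ
  have hθ0 : 0 < θ := by positivity
  have hθ1 : θ ≤ 1 := mul_le_one₀ hc1 (by positivity)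
    (Real.rpow_le_one_of_one_le_of_nonpos hJ1 (by linarith))
  have hbound : ∀ k ∈ natCube m J, ∀ k' ∈ natCube m J, k ≠ k' →
      θ ≤ ∏ u, dNI (∑ v, ((k v : ℝ) - k' v) * A u v) := by
    intro k hk k' hk' hne
    set j : Fin m → ℤ := fun v => (k v : ℤ) - k' v with hj
    have hj0 : j ≠ 0 := by
      intro h0
      apply hne
      funext v
      have := congrFun h0 v
      simp only [hj, Pi.zero_apply] at this
      omega
    have hjJ : jnorm j ≤ J := by
      refine Finset.sup_le fun v _ => ?_
      have h1 := Finset.mem_range.mp (Fintype.mem_piFinset.mp hk v)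
      have h2 := Finset.mem_range.mp (Fintype.mem_piFinset.mp hk' v)
      simp only [hj]
      omega
    have h3 := hA j hj0
    simp only [hj] at h3
    push_cast at h3
    refine le_trans ?_ h3
    have : (J : ℝ) ^ (-ω) ≤ (jnorm j : ℝ) ^ (-ω) :=
      Real.rpow_le_rpow_of_nonpos (by exact_mod_cast jnorm_pos hj0) (by exact_mod_cast hjJ)
        (by linarith)
    rw [hθ]
    gcongr
  have hmain := card_mul_le_exponential_sum A β hJ N F hF hclose
    ((N : ℝ) ^ d + C * θ ^ (-(1 + ε))) (by
      intro k hk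
      rw [← Finset.add_sum_erase _ _ hk]
      refine add_le_add ?_ ?_
      · simp [unitExp_zero]
      · refine le_trans (Finset.sum_le_sum fun k' hk' => ?_)
          (hsum (Fin m → ℕ) ((natCube m J).erase k)
            (fun k' u => ∑ v, ((k v : ℝ) - k' v) * A u v) θ hθ0 hθ1 ?_ ?_)
        · have hk'' := Finset.mem_erase.mp hk'
          have hpos := hθ0.trans_le (hbound k hk k' hk''.2 hk''.1.symm)
          rw [← Finset.prod_inv_distrib]
          refine Finset.prod_le_prod (fun _ _ => norm_nonneg _) fun u _ => ?_
          refine norm_sum_unitExp_le N (lt_of_le_of_ne (dNI_nonneg _) fun h0 => ?_)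
          exact hpos.ne' (Finset.prod_eq_zero (Finset.mem_univ u) h0.symm)
        · intro k' hk'
          have hk'' := Finset.mem_erase.mp hk'
          exact hbound k hk k' hk''.2 hk''.1.symm
        · intro k₁ hk₁ k₂ hk₂ hne
          have h := hbound k₂ (Finset.mem_erase.mp hk₂).2 k₁ (Finset.mem_erase.mp hk₁).2 hne.symm
          convert h using 3 with u
          rw [← Finset.sum_sub_distrib]
          refine Finset.sum_congr rfl fun v _ => ?_
          ring)
  have hθpow : C * θ ^ (-(1 + ε)) = C * c ^ (-(1 + ε)) * (J : ℝ) ^ (ω * (1 + ε)) := by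
    rw [hθ, Real.mul_rpow hc.le (by positivity), ← Real.rpow_mul hJ0.le]
    ring_nf
  rw [hθpow] at hmain
  have hG : (N : ℝ) ^ d + C * c ^ (-(1 + ε)) * (J : ℝ) ^ (ω * (1 + ε)) ≤
      C' * ((N : ℝ) ^ d + (J : ℝ) ^ (ω * (1 + ε))) := by
    rw [mul_add C']
    refine add_le_add (le_mul_of_one_le_left (by positivity) hC'1) ?_
    gcongr
    exact le_max_right _ _
  have h7 : (F.card : ℝ) * (((J : ℝ) / 2) ^ m) ^ 2 ≤
      J ^ m * (C' * ((N : ℝ) ^ d + (J : ℝ) ^ (ω * (1 + ε)))) :=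
    hmain.trans (by gcongr)
  rw [← le_div_iff₀ (by positivity)] at h7
  refine h7.trans (le_of_eq ?_)
  rw [div_pow, div_pow, ← pow_mul 2 m 2, mul_comm m 2, pow_mul 2 2 m]
  norm_num
  field_simp

/-- The Hausdorff–Cantelli lemma: a limsup set of balls with `∑ r ^ s < ∞` has zero
`s`-dimensional Hausdorff measure. -/
lemma hausdorffMeasure_eq_zero_of_summable_cover {X ι : Type*} [MetricSpace X]
    [MeasurableSpace X] [BorelSpace X] [Countable ι] {s : ℝ} (hs : 0 < s) (E : Set X)
    (c : ℕ → ι → X) (F : ℕ → Finset ι) (r : ℕ → ℝ) (hr0 : ∀ q, 0 ≤ r q)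
    (hr : Filter.Tendsto r Filter.atTop (nhds 0))
    (hsum : Summable fun q => ((F q).card : ℝ) * r q ^ s)
    (hE : ∀ x ∈ E, {q | ∃ b ∈ F q, dist x (c q b) ≤ r q}.Infinite) : μH[s] E = 0 := by
  classical
  set t : (N : ℕ) → ℕ × ι → Set X := fun N p =>
    if p.2 ∈ F (p.1 + N) then Metric.closedBall (c (p.1 + N) p.2) (r (p.1 + N)) else ∅ with ht
  set f : ℕ → ℝ≥0∞ := fun q => ENNReal.ofReal (2 * r q) with hf
  have hdiam : ∀ N p, Metric.ediam (t N p) ≤ f (p.1 + N) := by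
    intro N p
    simp only [ht, hf]
    split_ifs
    · refine Metric.ediam_le_of_forall_dist_le fun x hx y hy => ?_
      have h1 := dist_triangle_right x y (c (p.1 + N) p.2)
      linarith [Metric.mem_closedBall.mp hx, Metric.mem_closedBall.mp hy]
    · simp
  have hf0 : Filter.Tendsto f Filter.atTop (nhds 0) := by
    have := ENNReal.tendsto_ofReal (hr.const_mul 2)
    simpa [hf] using this
  have hsup : Filter.Tendsto (fun N => ⨆ q, f (q + N)) Filter.atTop (nhds 0) := by
    rw [ENNReal.tendsto_nhds_zero] at hf0 ⊢
    intro ε hε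
    obtain ⟨N₀, hN₀⟩ := Filter.eventually_atTop.mp (hf0 ε hε)
    exact Filter.eventually_atTop.mpr ⟨N₀, fun N hN => iSup_le fun q => hN₀ _ (by omega)⟩
  have hle := Measure.hausdorffMeasure_le_liminf_tsum s E (fun N => ⨆ q, f (q + N)) hsup t
    (Filter.Eventually.of_forall fun N p => (hdiam N p).trans (le_iSup (fun q => f (q + N)) p.1))
    (Filter.Eventually.of_forall fun N x hx => by
      obtain ⟨q, ⟨b, hb, hxb⟩, hq⟩ := (hE x hx).exists_gt N
      refine Set.mem_iUnion.mpr ⟨(q - N, b), ?_⟩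
      have h1 : q - N + N = q := by omega
      simp only [ht, h1, hb, if_true]
      exact hxb)
  set g : ℕ → ℝ≥0∞ := fun q => ENNReal.ofReal (2 ^ s * (((F q).card : ℝ) * r q ^ s)) with hg
  have hgsum : ∑' q, g q ≠ ⊤ := by
    have := (hsum.mul_left (2 ^ s)).tsum_ofReal_ne_top
    exact this
  have hbd : ∀ N, ∑' p, Metric.ediam (t N p) ^ s ≤ ∑' q, g (q + N) := by
    intro N
    rw [ENNReal.tsum_prod']
    refine ENNReal.tsum_le_tsum fun q => ?_
    rw [tsum_eq_sum (s := F (q + N)) (fun b hb => by simp [ht, hb, hs])]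
    calc ∑ b ∈ F (q + N), Metric.ediam (t N (q, b)) ^ s
        ≤ (F (q + N)).card • f (q + N) ^ s :=
          Finset.sum_le_card_nsmul _ _ _ fun b _ => by
            gcongr
            exact hdiam N (q, b)
      _ = g (q + N) := by
          simp only [hf, hg]
          rw [ENNReal.ofReal_rpow_of_nonneg (by linarith [hr0 (q + N)]) hs.le, nsmul_eq_mul,
            ← ENNReal.ofReal_natCast, ← ENNReal.ofReal_mul (by positivity),
            Real.mul_rpow (by norm_num) (hr0 _)]
          congr 1
          ring
  refine le_antisymm (hle.trans ?_) zero_le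
  calc _ ≤ Filter.liminf (fun N => ∑' q, g (q + N)) Filter.atTop :=
        Filter.liminf_le_liminf (Filter.Eventually.of_forall hbd)
    _ = 0 := (ENNReal.tendsto_sum_nat_add g hgsum).liminf_eq
    _ ≤ 0 := le_rfl

/-- Replacing `ψ` by its maximum with a small power of `q` preserves convergence. -/
lemma summable_max_rpow {ψ : ℕ → ℝ} (hψ : ∀ q, 0 ≤ ψ q) {p η e : ℝ} (hp : 0 < p) (hη : 0 < η)
    (hηp : e + 1 < η * p)
    (hsum : Summable fun q : ℕ => ψ q ^ p * (q : ℝ) ^ e) :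
    Summable fun q : ℕ => max (ψ q) ((q : ℝ) ^ (-η)) ^ p * (q : ℝ) ^ e := by
  have h1 : Summable fun q : ℕ => (q : ℝ) ^ (-(η * p) + e) :=
    Real.summable_nat_rpow.mpr (by linarith)
  refine Summable.of_nonneg_of_le (fun q => ?_) (fun q => ?_) (hsum.add h1)
  · have : 0 ≤ max (ψ q) ((q : ℝ) ^ (-η)) := le_max_of_le_left (hψ q)
    positivity
  · have h2 : ((q : ℝ) ^ (-η)) ^ p * (q : ℝ) ^ e ≤ (q : ℝ) ^ (-(η * p) + e) := by
      rcases Nat.eq_zero_or_pos q with rfl | hq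
      · rw [Nat.cast_zero, Real.zero_rpow (by linarith), Real.zero_rpow hp.ne', zero_mul]
        positivity
      · have hq0 : (0 : ℝ) < q := by exact_mod_cast hq
        rw [← Real.rpow_mul hq0.le, ← Real.rpow_add hq0, neg_mul]
    have h3 : 0 ≤ ψ q ^ p * (q : ℝ) ^ e := mul_nonneg (Real.rpow_nonneg (hψ q) _) (by positivity)
    rcases max_cases (ψ q) ((q : ℝ) ^ (-η)) with ⟨h, -⟩ | ⟨h, -⟩ <;> rw [h]
    · have : 0 ≤ (q : ℝ) ^ (-(η * p) + e) := by positivity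
      linarith
    · linarith

lemma tendsto_zero_of_summable_rpow {δ : ℕ → ℝ} (hδ : ∀ q, 0 ≤ δ q) {p e : ℝ} (hp : 0 < p)
    (he : 0 ≤ e) (hsum : Summable fun q : ℕ => δ q ^ p * (q : ℝ) ^ e) :
    Filter.Tendsto δ Filter.atTop (nhds 0) := by
  have h1 : Filter.Tendsto (fun q => δ q ^ p) Filter.atTop (nhds 0) := by
    refine squeeze_zero' (Filter.Eventually.of_forall fun q => Real.rpow_nonneg (hδ q) _) ?_
      hsum.tendsto_atTop_zero
    filter_upwards [Filter.eventually_ge_atTop 1] with q hq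
    exact le_mul_of_one_le_right (Real.rpow_nonneg (hδ q) _)
      (Real.one_le_rpow (by exact_mod_cast hq) he)
  have h2 := h1.rpow_const (p := p⁻¹) (Or.inr (inv_nonneg.mpr hp.le))
  rw [Real.zero_rpow (inv_pos.mpr hp).ne'] at h2
  refine h2.congr fun q => ?_
  rw [← Real.rpow_mul (hδ q), mul_inv_cancel₀ hp.ne', Real.rpow_one]

/-- The bounded part of the limsup set, in the parameter space of the affine subspace, is null. -/
lemma hausdorffMeasure_bounded_limsup_eq_zero {d m : ℕ} (hd : 1 ≤ d)
    (α₀ : Fin m → ℝ) (A : Matrix (Fin d) (Fin m) ℝ) {s : ℝ} (hs : 0 < s) (hsd : s ≤ d)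
    (ψ : ℕ → ℝ) (hψ : ∀ q, 0 ≤ ψ q)
    (hsum : Summable fun q : ℕ => ψ q ^ ((m : ℝ) + s) * (q : ℝ) ^ ((d : ℝ) - s))
    (hω : multType A < ENNReal.ofReal ((d : ℝ) * ((m : ℝ) + s) / ((d : ℝ) + 1 - s))) (R : ℕ) :
    μH[s] {x : Fin d → ℝ | (∀ i, |x i| ≤ R) ∧
      {q : ℕ | 0 < q ∧ (∀ i, dNI ((q : ℝ) * x i) < ψ q) ∧
        (∀ v, dNI ((q : ℝ) * (α₀ v + ∑ u, x u * A u v)) < ψ q)}.Infinite} = 0 := by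
  classical
  have hd0 : (0 : ℝ) < d := by exact_mod_cast hd
  have hden : 0 < (d : ℝ) + 1 - s := by linarith
  have hp : 0 < (m : ℝ) + s := by positivity
  set T := (d : ℝ) * ((m : ℝ) + s) / ((d : ℝ) + 1 - s) with hT
  obtain ⟨ω, hω0, hωT, c, hc, hc1, hA⟩ := exists_lower_bound_of_multType_lt A T hω
  set τ := (ω + T) / 2 with hτ
  have hωτ : ω < τ := by linarith
  have hτT : τ < T := by linarith
  have hτ0 : 0 < τ := hω0.trans hωτ
  set η := d / τ with hη
  have hη0 : 0 < η := by positivity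
  have hηp : (d : ℝ) - s + 1 < η * ((m : ℝ) + s) := by
    rw [hη, div_mul_eq_mul_div, lt_div_iff₀ hτ0]
    rw [hT, lt_div_iff₀ hden] at hτT
    linarith
  set ε := τ / ω - 1 with hε
  have hε0 : 0 < ε := sub_pos.mpr ((one_lt_div hω0).mpr hωτ)
  have hκ : ω * (1 + ε) = τ := by rw [hε]; field_simp; ring
  obtain ⟨C, hC, hcount⟩ := exists_card_le hd A hω0 hc hc1 hε0 hA
  rw [hκ] at hcount
  set δ : ℕ → ℝ := fun q => max (ψ q) ((q : ℝ) ^ (-η)) with hδ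
  have hδ0 : ∀ q, 0 ≤ δ q := fun q => le_max_of_le_left (hψ q)
  have hδsum := summable_max_rpow hψ hp hη0 hηp hsum
  have hδlim : Filter.Tendsto δ Filter.atTop (nhds 0) :=
    tendsto_zero_of_summable_rpow hδ0 hp (by linarith) hδsum
  set K := 1 + ∑ u, ∑ v, |A u v| with hK
  have hK1 : 1 ≤ K := le_add_of_nonneg_right (by positivity)
  have hK0 : 0 < K := by linarith
  set L : ℕ → ℕ := fun q => (R + 1) * q with hL
  set F : ℕ → Finset (Fin d → ℕ) := fun q => (natCube d (2 * L q + 1)).filter fun b =>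
    ∀ v, dNI ((q * α₀ v - ∑ u, (L q : ℝ) * A u v) + ∑ u, (b u : ℝ) * A u v) ≤ K * δ q with hF
  have hcard : ∀ᶠ q in Filter.atTop,
      ((F q).card : ℝ) ≤ (C * (16 * K) ^ m * ((2 * R + 3) ^ d + 1)) * (δ q ^ m * (q : ℝ) ^ d) := by
    have hev : ∀ᶠ q in Filter.atTop, δ q < 1 / (8 * K) :=
      hδlim.eventually_lt_const (by positivity)
    filter_upwards [hev, Filter.eventually_ge_atTop 1] with q hq hq1
    have hq1' : (1 : ℝ) ≤ q := by exact_mod_cast hq1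
    have hq0 : (0 : ℝ) < q := by linarith
    have hδq : 0 < δ q := lt_max_of_lt_right (Real.rpow_pos_of_pos hq0 _)
    set y := 1 / (8 * (K * δ q)) with hy
    have hy0 : 0 < y := by positivity
    have hy1 : 1 ≤ y := by
      rw [hy, one_le_div (by positivity)]
      rw [lt_div_iff₀ (by positivity)] at hq
      linarith
    set J := ⌊y⌋₊ with hJ
    have hJ1 : 1 ≤ J := Nat.le_floor (by exact_mod_cast hy1)
    have hJ1' : (1 : ℝ) ≤ J := by exact_mod_cast hJ1
    have hJ0 : (0 : ℝ) < J := by linarith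
    have hJy : (J : ℝ) ≤ y := Nat.floor_le hy0.le
    have hyJ : y ≤ 2 * J := by linarith [Nat.lt_floor_add_one y]
    have hKδJ : K * δ q ≤ 1 / (8 * J) := by
      rw [hy, le_div_iff₀ (by positivity)] at hJy
      rw [le_div_iff₀ (by positivity)]
      linarith
    have h1 := hcount (fun v => q * α₀ v - ∑ u, (L q : ℝ) * A u v) J (2 * L q + 1) hJ1 (F q)
      (Finset.filter_subset _ _)
      (fun b hb v => ((Finset.mem_filter.mp hb).2 v).trans hKδJ)
    have hJinv : 1 / (J : ℝ) ≤ 16 * K * δ q := by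
      rw [hy, div_le_iff₀ (by positivity)] at hyJ
      rw [div_le_iff₀ hJ0]
      linarith
    have hJη : (J : ℝ) ^ τ ≤ (q : ℝ) ^ d := by
      have h2 : (J : ℝ) ≤ (q : ℝ) ^ η := by
        have h3 : (q : ℝ) ^ (-η) ≤ δ q := le_max_right _ _
        rw [Real.rpow_neg hq0.le] at h3
        have h4 : (δ q)⁻¹ ≤ (q : ℝ) ^ η := inv_le_of_inv_le₀ (by positivity) h3
        refine hJy.trans (le_trans ?_ h4)
        rw [hy, one_div]
        refine inv_anti₀ hδq ?_
        nlinarith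
      calc (J : ℝ) ^ τ ≤ ((q : ℝ) ^ η) ^ τ := by gcongr
        _ = (q : ℝ) ^ d := by
            rw [← Real.rpow_mul hq0.le, hη, div_mul_cancel₀ _ hτ0.ne', Real.rpow_natCast]
    have hN : ((2 * L q + 1 : ℕ) : ℝ) ≤ (2 * R + 3) * q := by
      simp only [hL]
      push_cast
      linarith
    calc ((F q).card : ℝ) ≤ _ := h1
      _ = C * (1 / (J : ℝ)) ^ m * (((2 * L q + 1 : ℕ) : ℝ) ^ d + (J : ℝ) ^ τ) := by
          rw [one_div_pow, mul_one_div]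
      _ ≤ C * (16 * K * δ q) ^ m * (((2 * R + 3) * q) ^ d + (q : ℝ) ^ d) := by gcongr
      _ = _ := by rw [mul_pow (16 * K), mul_pow (2 * (R : ℝ) + 3)]; ring
  refine hausdorffMeasure_eq_zero_of_summable_cover hs _
    (fun q b i => ((b i : ℝ) - L q) / q) F (fun q => δ q / q)
    (fun q => div_nonneg (hδ0 q) (Nat.cast_nonneg q)) ?_ ?_ ?_
  · refine squeeze_zero (fun q => div_nonneg (hδ0 q) (Nat.cast_nonneg q)) (fun q => ?_) hδlim
    rcases Nat.eq_zero_or_pos q with rfl | hq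
    · simpa using hδ0 0
    · exact div_le_self (hδ0 q) (by exact_mod_cast hq)
  · refine Summable.of_norm_bounded_eventually_nat
      (hδsum.mul_left (C * (16 * K) ^ m * ((2 * R + 3) ^ d + 1))) ?_
    filter_upwards [hcard, Filter.eventually_ge_atTop 1] with q hq hq1
    have hq0 : (0 : ℝ) < q := by exact_mod_cast hq1
    have hδq : 0 < δ q := lt_max_of_lt_right (Real.rpow_pos_of_pos hq0 _)
    rw [Real.norm_of_nonneg (by positivity)]
    calc ((F q).card : ℝ) * (δ q / q) ^ s
        ≤ ((C * (16 * K) ^ m * ((2 * R + 3) ^ d + 1)) * (δ q ^ m * (q : ℝ) ^ d)) *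
          (δ q / q) ^ s := by gcongr
      _ = _ := by
          rw [Real.div_rpow hδq.le hq0.le, Real.rpow_add hδq, Real.rpow_natCast,
            Real.rpow_sub hq0, Real.rpow_natCast]
          ring
  · rintro x ⟨hxR, hinf⟩
    refine hinf.mono ?_
    rintro q ⟨hq, hx, hv⟩
    have hq0 : (0 : ℝ) < q := by exact_mod_cast hq
    have hq1 : (1 : ℝ) ≤ q := by exact_mod_cast hq
    have hround : ∀ i, |(round ((q : ℝ) * x i) : ℝ)| ≤ L q := by
      intro i
      have h1 : |(q : ℝ) * x i| ≤ q * R := by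
        rw [abs_mul, Nat.abs_cast]
        exact mul_le_mul_of_nonneg_left (hxR i) hq0.le
      have h2 := abs_sub_round ((q : ℝ) * x i)
      have h3 : |(round ((q : ℝ) * x i) : ℝ)| ≤ |(q : ℝ) * x i| + 1 / 2 := by
        have := abs_sub_abs_le_abs_sub (round ((q : ℝ) * x i) : ℝ) ((q : ℝ) * x i)
        rw [abs_sub_comm] at this
        linarith
      simp only [hL]
      push_cast
      linarith
    have hroundZ : ∀ i, |round ((q : ℝ) * x i)| ≤ (L q : ℤ) := fun i => by
      exact_mod_cast hround i
    set b : Fin d → ℕ := fun i => (round ((q : ℝ) * x i) + L q).toNat with hb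
    have hbi : ∀ i, (b i : ℤ) = round ((q : ℝ) * x i) + L q := fun i =>
      Int.toNat_of_nonneg (by linarith [(abs_le.mp (hroundZ i)).1])
    have hbr : ∀ i, (b i : ℝ) = round ((q : ℝ) * x i) + L q := fun i => by
      exact_mod_cast hbi i
    have hclose : ∀ i, |(q : ℝ) * x i - round ((q : ℝ) * x i)| ≤ δ q := fun i =>
      (hx i).le.trans (le_max_left _ _)
    refine ⟨b, Finset.mem_filter.mpr ⟨?_, fun v => ?_⟩, ?_⟩
    · refine Fintype.mem_piFinset.mpr fun i => Finset.mem_range.mpr ?_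
      have h1 := hbi i
      have h2 := (abs_le.mp (hroundZ i)).2
      omega
    · refine (dNI_le_add_abs_sub _ ((q : ℝ) * (α₀ v + ∑ u, x u * A u v))).trans ?_
      have h1 : (q * α₀ v - ∑ u, (L q : ℝ) * A u v) + ∑ u, (b u : ℝ) * A u v -
          (q : ℝ) * (α₀ v + ∑ u, x u * A u v) =
          -∑ u, ((q : ℝ) * x u - round ((q : ℝ) * x u)) * A u v := by
        have h2 : ∑ u, (b u : ℝ) * A u v = ∑ u, (round ((q : ℝ) * x u) : ℝ) * A u v +
            ∑ u, (L q : ℝ) * A u v := by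
          rw [← Finset.sum_add_distrib]
          exact Finset.sum_congr rfl fun u _ => by rw [hbr, add_mul]
        simp_rw [sub_mul]
        rw [h2, Finset.sum_sub_distrib, mul_add, Finset.mul_sum]
        simp_rw [mul_assoc]
        ring
      rw [h1, abs_neg]
      have h3 : |∑ u, ((q : ℝ) * x u - round ((q : ℝ) * x u)) * A u v| ≤
          δ q * ∑ u, ∑ v, |A u v| := by
        refine (Finset.abs_sum_le_sum_abs _ _).trans ?_
        rw [Finset.mul_sum]
        refine Finset.sum_le_sum fun u _ => ?_
        rw [abs_mul]
        refine mul_le_mul (hclose u) ?_ (abs_nonneg _) (hδ0 q)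
        exact Finset.single_le_sum (f := fun v => |A u v|) (fun _ _ => abs_nonneg _)
          (Finset.mem_univ v)
      have h4 : dNI ((q : ℝ) * (α₀ v + ∑ u, x u * A u v)) ≤ δ q :=
        (hv v).le.trans (le_max_left _ _)
      rw [hK]
      linarith
    · refine (dist_pi_le_iff (div_nonneg (hδ0 q) hq0.le)).mpr fun i => ?_
      rw [hbr, Real.dist_eq, add_sub_cancel_right, le_div_iff₀ hq0]
      calc |x i - round ((q : ℝ) * x i) / q| * q
          = |(x i - round ((q : ℝ) * x i) / q) * q| := by rw [abs_mul, Nat.abs_cast]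
        _ = |(q : ℝ) * x i - round ((q : ℝ) * x i)| := by
            congr 1
            field_simp
        _ ≤ δ q := hclose i

/-- Theorem 2 of the paper: the convergence case of the generalized
Baker–Schmidt problem for an affine subspace, with no monotonicity on `ψ`.
We realize `ℝ^n` as `ℝ^d × ℝ^{n-d}` (with the sup metric, which is the metric
of `ℝ^n` with the sup norm), and `H` as the set of points `(x, (1,x)·Ã)`. -/
theorem strong_Jarnik_type_for_convergence
    (n d : ℕ) (hd : 1 ≤ d) (hdn : d < n)
    (α₀ : Fin (n - d) → ℝ) (A : Matrix (Fin d) (Fin (n - d)) ℝ)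
    (Atil : Matrix (Fin (d + 1)) (Fin (n - d)) ℝ)
    (hAtil : Atil = Matrix.of (Fin.cons α₀ A))
    (s : ℝ) (hs : 0 < s) (hsd : s ≤ d)
    (ψ : ℕ → ℝ) (hψ : ∀ q, 0 ≤ ψ q)
    (hsum : Summable fun q : ℕ => ψ q ^ ((n : ℝ) - d + s) * (q : ℝ) ^ ((d : ℝ) - s))
    (hω : multType A < ENNReal.ofReal ((d : ℝ) * ((n : ℝ) - d + s) / ((d : ℝ) + 1 - s))) :
    μH[s] {p : (Fin d → ℝ) × (Fin (n - d) → ℝ) |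
      (∃ x : Fin d → ℝ, p = (x, fun v => ∑ u, (Fin.cons (1 : ℝ) x : Fin (d+1) → ℝ) u * Atil u v)) ∧
      {q : ℕ | 0 < q ∧ (∀ i, dNI ((q : ℝ) * p.1 i) < ψ q) ∧
        (∀ v, dNI ((q : ℝ) * p.2 v) < ψ q)}.Infinite} = 0 := by
  have hcast : ((n - d : ℕ) : ℝ) = (n : ℝ) - d := Nat.cast_sub hdn.le
  rw [← hcast] at hsum hω
  set Φ : (Fin d → ℝ) → (Fin d → ℝ) × (Fin (n - d) → ℝ) := fun x =>
    (x, α₀ + LinearMap.toContinuousLinearMap (Matrix.vecMulLinear A) x) with hΦ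
  have hΦv : ∀ x v, (Φ x).2 v = α₀ v + ∑ u, x u * A u v := fun x v => rfl
  have hAv : ∀ (x : Fin d → ℝ) v,
      ∑ u, (Fin.cons (1 : ℝ) x : Fin (d + 1) → ℝ) u * Atil u v = (Φ x).2 v := by
    intro x v
    rw [hΦv, hAtil, Fin.sum_univ_succ]
    simp only [Fin.cons_zero, Fin.cons_succ, one_mul]
    rfl
  have hLip : LipschitzWith _ Φ := LipschitzWith.id.prodMk
    ((LipschitzWith.const α₀).add
      (LinearMap.toContinuousLinearMap (Matrix.vecMulLinear A)).lipschitz)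
  set E : ℕ → Set (Fin d → ℝ) := fun R => {x : Fin d → ℝ | (∀ i, |x i| ≤ R) ∧
      {q : ℕ | 0 < q ∧ (∀ i, dNI ((q : ℝ) * x i) < ψ q) ∧
        (∀ v, dNI ((q : ℝ) * (α₀ v + ∑ u, x u * A u v)) < ψ q)}.Infinite} with hE
  have hzero : μH[s] (Φ '' ⋃ R, E R) = 0 := by
    refine le_antisymm ((hLip.hausdorffMeasure_image_le hs.le _).trans ?_) zero_le
    rw [measure_iUnion_null fun R =>
      hausdorffMeasure_bounded_limsup_eq_zero hd α₀ A hs hsd ψ hψ hsum hω R, mul_zero]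
  refine measure_mono_null ?_ hzero
  rintro _ ⟨⟨x, rfl⟩, hinf⟩
  refine ⟨x, Set.mem_iUnion.mpr ?_, ?_⟩
  · obtain ⟨R, hR⟩ := exists_nat_ge ‖x‖
    refine ⟨R, fun i => (norm_le_pi_norm x i).trans hR, ?_⟩
    simpa only [hAv, hΦv] using hinf
  · refine Prod.ext rfl (funext fun v => (hAv x v).symm)
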